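/- Let F be a field of characteristic 2, let u, v ∈ F* be such that E = F(μ,ν) with μ² + μ + u = 0 and ν² + ν + v = 0 is a separable biquadratic extension of degree 4. Set γ = μν + u + v; then E = F(γ), the minimal polynomial of γ over F is f(X) = X⁴ + X³ + (u² + v² + uv)X + (u²v + uv² + u²v² + u⁴ + v⁴), and its cubic resolvent is f_C(X) = X³ + (u² + v² + uv)X + (u²v + uv²) = (X+u)(X+v)(X+u+v). Moreover, with d = u²v + uv² + u²v² + u⁴ + v⁴ and, for e ∈ F* with f_C(e) ≠ 0, r = e+u, s = e+v, t = e+u+v, one has the identity in the Witt group W_qF: ⟨⟨f_C(e), d/e²]] = ⟨1,r,rs,rst⟩_b ⊗ [1,u] + ⟨r,rst⟩_b ⊗ [1,v]. Consequently W_q(E/F) is generated as a WF-module by [1,u] and [1,v]. -/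

import Mathlib

open QuadraticMap

variable (F : Type) [Field F]

/-- Quadratic forms on `Fin n → F`. -/
abbrev QF (n : ℕ) := QuadraticForm F (Fin n → F)

/-- The nonsingular binary quadratic form `[a,b] = a x² + x y + b y²`. -/
noncomputable def binQF (a b : F) : QF F 2 :=
  (Matrix.of ![![a, 1], ![0, b]]).toQuadraticMap'

/-- The totally singular diagonal quadratic form `⟨c₁, …, c_n⟩ = Σ cᵢ xᵢ²`. -/
noncomputable def diagQF {n : ℕ} (c : Fin n → F) : QF F n :=
  QuadraticMap.weightedSumSquares F c

/-- Orthogonal sum of a finite family of quadratic forms of the same dimension. -/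
noncomputable def oSumFam {k n : ℕ} (q : Fin k → QF F n) : QF F (k * n) :=
  (QuadraticMap.pi q).comp
    ((LinearEquiv.curry F F (Fin k) (Fin n)).toLinearMap.comp
      (LinearEquiv.funCongrLeft F F finProdFinEquiv).toLinearMap)

/-- Orthogonal sum of two quadratic forms. -/
noncomputable def oSum {n m : ℕ} (q₁ : QF F n) (q₂ : QF F m) : QF F (n + m) :=
  (QuadraticMap.prod q₁ q₂).comp
    ((LinearEquiv.sumArrowLequivProdArrow (Fin n) (Fin m) F F).toLinearMap.comp
      (LinearEquiv.funCongrLeft F F finSumFinEquiv).toLinearMap)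

section General
variable {M N : Type} [AddCommGroup M] [Module F M] [AddCommGroup N] [Module F N]

/-- Two quadratic forms are isometric if there is an isometry (isomorphism preserving the
form) between them. -/
def QIsometric (q₁ : QuadraticForm F M) (q₂ : QuadraticForm F N) : Prop :=
  Nonempty (QuadraticMap.IsometryEquiv q₁ q₂)

/-- `q₁` is dominated by `q₂` (written `q₁ ≺ q₂`) if there is an injective linear map `t`
with `q₁ x = q₂ (t x)` for all `x`. -/
def Dominates (q₁ : QuadraticForm F M) (q₂ : QuadraticForm F N) : Prop :=
  ∃ t : M →ₗ[F] N, Function.Injective t ∧ ∀ x, q₁ x = q₂ (t x)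

/-- A quadratic form is nonsingular if the radical of its polar form is trivial. -/
def Nonsingular (q : QuadraticForm F M) : Prop :=
  ∀ x, (∀ y, polar q x y = 0) → x = 0

/-- A quadratic form is totally singular if its polar form vanishes identically. -/
def TotallySingular (q : QuadraticForm F M) : Prop :=
  ∀ x y, polar q x y = 0

/-- A quadratic form is hyperbolic if it is isometric to an orthogonal sum of
hyperbolic planes `ℍ = [0,0]`. -/
def Hyperbolic (q : QuadraticForm F M) : Prop :=
  ∃ k : ℕ, QIsometric F q (oSumFam F fun _ : Fin k => binQF F 0 0)

/-- Witt equivalence: two quadratic forms are Witt equivalent iff they have isometric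
anisotropic parts, i.e. both are isometric to `i × ℍ ⊥ ρ ⊥ j × ⟨0⟩` for a common
anisotropic form `ρ`. -/
def WittEquiv (q₁ : QuadraticForm F M) (q₂ : QuadraticForm F N) : Prop :=
  ∃ (r : ℕ) (ρ : QF F r), ρ.Anisotropic ∧
    (∃ i j : ℕ, QIsometric F q₁
      (oSum F (oSum F (oSumFam F fun _ : Fin i => binQF F 0 0) ρ) (diagQF F (0 : Fin j → F)))) ∧
    (∃ i j : ℕ, QIsometric F q₂
      (oSum F (oSum F (oSumFam F fun _ : Fin i => binQF F 0 0) ρ) (diagQF F (0 : Fin j → F))))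

end General

/-- The Gram-type matrix of a quadratic form on `Fin n → F`: diagonal entries are the values
on basis vectors, above-diagonal entries the polar values. -/
noncomputable def qMat {n : ℕ} (q : QF F n) : Matrix (Fin n) (Fin n) F :=
  Matrix.of fun i j =>
    if i = j then q (Pi.single i 1)
    else if i < j then polar q (Pi.single i 1) (Pi.single j 1) else 0

/-- Scalar extension of a quadratic form along `F → E`. -/
noncomputable def extQF (E : Type) [CommRing E] [Algebra F E] {n : ℕ} (q : QF F n) :
    QuadraticForm E (Fin n → E) :=
  ((qMat F q).map (algebraMap F E)).toQuadraticMap'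

/-- Membership of the Witt class of `q` in the kernel `W_q(E/F)` of `W_qF → W_qE`:
the scalar extension of `q` is Witt equivalent to the zero form. -/
def InWqKernel (E : Type) [Field E] [Algebra F E] {n : ℕ} (q : QF F n) : Prop :=
  WittEquiv E (extQF F E q) (0 : QF E 0)

/-- The 2-fold quadratic Pfister form `⟨⟨g,h]] = ⟨1,g⟩_b ⊗ [1,h] = [1,h] ⊥ g[1,h]`. -/
noncomputable def pf2 (g h : F) : QF F 4 :=
  oSum F (binQF F 1 h) (g • binQF F 1 h)

/-- The 3-fold quadratic Pfister form `⟨⟨g₁,g₂,h]] = ⟨1,g₁⟩_b ⊗ ⟨1,g₂⟩_b ⊗ [1,h]`. -/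
noncomputable def pf3 (g₁ g₂ h : F) : QF F 8 :=
  oSum F (pf2 F g₂ h) (g₁ • pf2 F g₂ h)

/-- Orthogonal sum of a list of quadratic forms of varying dimensions. -/
noncomputable def listOSum : List (Σ n, QF F n) → Σ n, QF F n
  | [] => ⟨0, 0⟩
  | x :: L => ⟨x.1 + (listOSum L).1, oSum F x.2 (listOSum L).2⟩

/-- The cubic resolvent `f_C(X) = X³ + bX² + acX + (a²d + c²)` of
`f(X) = X⁴ + aX³ + bX² + cX + d`, evaluated at `e`. -/
def cubicResolvent (a b c d e : F) : F := e ^ 3 + b * e ^ 2 + a * c * e + (a ^ 2 * d + c ^ 2)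

section WittKernel

open Module

variable {F}

section WittRel

variable {V V₁ V₂ V₃ V₄ : Type}
  [AddCommGroup V] [Module F V] [AddCommGroup V₁] [Module F V₁] [AddCommGroup V₂] [Module F V₂]
  [AddCommGroup V₃] [Module F V₃] [AddCommGroup V₄] [Module F V₄]

/-- A Lagrangian correspondence between two quadratic forms: a subspace of the product, of at
least half the dimension, on which the two forms agree. -/
def WittRel (q₁ : QuadraticForm F V₁) (q₂ : QuadraticForm F V₂) : Prop :=
  ∃ L : Submodule F (V₁ × V₂), finrank F V₁ + finrank F V₂ ≤ 2 * finrank F L ∧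
    ∀ p ∈ L, q₁ p.1 = q₂ p.2

theorem WittRel.of_injective {q₁ : QuadraticForm F V₁} {q₂ : QuadraticForm F V₂}
    (f : V →ₗ[F] V₁ × V₂) (hf : Function.Injective f)
    (hdim : finrank F V₁ + finrank F V₂ ≤ 2 * finrank F V)
    (h : ∀ x, q₁ (f x).1 = q₂ (f x).2) : WittRel q₁ q₂ := by
  refine ⟨LinearMap.range f, ?_, ?_⟩
  · rwa [LinearMap.finrank_range_of_inj hf]
  · rintro _ ⟨x, rfl⟩
    exact h x

theorem WittRel.of_isometric {q₁ : QuadraticForm F V₁} {q₂ : QuadraticForm F V₂}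
    (h : QIsometric F q₁ q₂) : WittRel q₁ q₂ := by
  obtain ⟨e⟩ := h
  refine .of_injective (LinearMap.prod LinearMap.id (e.toLinearEquiv : V₁ →ₗ[F] V₂))
    (fun x y hxy => (Prod.ext_iff.1 hxy).1) ?_ fun x => (e.map_app x).symm
  rw [← e.toLinearEquiv.finrank_eq]
  omega

theorem WittRel.of_isometric_left {q₁ : QuadraticForm F V₁} {q₂ : QuadraticForm F V₂}
    {q₃ : QuadraticForm F V₃} (h : QIsometric F q₁ q₂) (h' : WittRel q₂ q₃) : WittRel q₁ q₃ := by
  obtain ⟨e⟩ := h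
  obtain ⟨L, hL, h⟩ := h'
  refine .of_injective ((e.symm.toLinearEquiv.toLinearMap.prodMap LinearMap.id) ∘ₗ L.subtype)
    ((Prod.map_injective.2 ⟨e.symm.toLinearEquiv.injective, Function.injective_id⟩).comp
      L.subtype_injective) ?_ ?_
  · rwa [e.toLinearEquiv.finrank_eq]
  · intro x
    exact (e.symm.map_app _).trans (h _ x.2)

theorem WittRel.refl (q : QuadraticForm F V) : WittRel q q :=
  .of_isometric ⟨.refl q⟩

theorem WittRel.symm {q₁ : QuadraticForm F V₁} {q₂ : QuadraticForm F V₂}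
    (h : WittRel q₁ q₂) : WittRel q₂ q₁ := by
  obtain ⟨L, hL, h⟩ := h
  refine .of_injective ((LinearEquiv.prodComm F V₁ V₂).toLinearMap ∘ₗ L.subtype)
    ((LinearEquiv.prodComm F V₁ V₂).injective.comp L.subtype_injective) (by omega)
    fun x => (h _ x.2).symm

/-- Mutually orthogonal subspaces of a nonsingular space have complementary dimensions at most. -/
theorem finrank_add_finrank_le_of_polar_eq_zero [FiniteDimensional F V] {q : QuadraticForm F V}
    (hq : Nonsingular F q) (R N : Submodule F V) (h : ∀ x ∈ R, ∀ y ∈ N, polar q y x = 0) :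
    finrank F R + finrank F N ≤ finrank F V := by
  have hB : ∀ y ∈ N, q.polarBilin y ∈ R.dualAnnihilator := fun y hy =>
    (Submodule.mem_dualAnnihilator _).2 fun x hx => h x hx y hy
  have hinj : Function.Injective (q.polarBilin.restrict hB) := by
    refine (injective_iff_map_eq_zero _).2 fun y hy => Subtype.ext (hq _ fun z => ?_)
    exact congrArg (fun f => f.1 z) hy
  have h1 : finrank F N ≤ finrank F R.dualAnnihilator :=
    LinearMap.finrank_le_finrank_of_injective hinj
  have h2 := Subspace.finrank_add_finrank_dualAnnihilator_eq R
  omega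

theorem finrank_le_finrank_add_finrank_map_ker [FiniteDimensional F V] [FiniteDimensional F V₁]
    [FiniteDimensional F V₂] {q : QuadraticForm F V₂} (hq : Nonsingular F q) (b δ : V →ₗ[F] V₂)
    (π : V →ₗ[F] V₁) (hb : ∀ x, δ x = 0 → π x = 0 → b x = 0 → x = 0)
    (horth : ∀ x y, δ y = 0 → π y = 0 → polar q (b y) (δ x) = 0) :
    finrank F V ≤ finrank F V₂ + finrank F ((LinearMap.ker δ).map π) := by
  have hdisj : LinearMap.ker (b.domRestrict (LinearMap.ker (δ.prod π))) = ⊥ := by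
    refine LinearMap.ker_eq_bot'.2 fun x hx => Subtype.ext ?_
    have := Prod.ext_iff.1 (LinearMap.mem_ker.1 x.2)
    exact hb _ this.1 this.2 hx
  have d₁ := finrank_add_finrank_le_of_polar_eq_zero hq (LinearMap.range δ)
    (LinearMap.range (b.domRestrict (LinearMap.ker (δ.prod π)))) (by
      rintro _ ⟨x, rfl⟩ _ ⟨y, rfl⟩
      have := Prod.ext_iff.1 (LinearMap.mem_ker.1 y.2)
      exact horth x _ this.1 this.2)
  rw [LinearMap.finrank_range_of_inj (LinearMap.ker_eq_bot.1 hdisj)] at d₁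
  have d₂ := LinearMap.finrank_range_add_finrank_ker δ
  have d₃ := LinearMap.finrank_range_add_finrank_ker (π.domRestrict (LinearMap.ker δ))
  rw [LinearMap.range_domRestrict] at d₃
  have d₄ : finrank F (LinearMap.ker (π.domRestrict (LinearMap.ker δ)))
      = finrank F (LinearMap.ker (δ.prod π)) := by
    rw [LinearMap.ker_domRestrict, LinearMap.ker_prod, ← Submodule.map_comap_subtype]
    exact (Submodule.equivSubtypeMap (LinearMap.ker δ) _).finrank_eq
  omega

theorem WittRel.trans [FiniteDimensional F V₁] [FiniteDimensional F V₂] [FiniteDimensional F V₃]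
    {q₁ : QuadraticForm F V₁} {q₂ : QuadraticForm F V₂} {q₃ : QuadraticForm F V₃}
    (hq : Nonsingular F q₂) (h₁₂ : WittRel q₁ q₂) (h₂₃ : WittRel q₂ q₃) : WittRel q₁ q₃ := by
  obtain ⟨L, hL, h⟩ := h₁₂
  obtain ⟨L', hL', h'⟩ := h₂₃
  have hpol : ∀ z ∈ L, ∀ l ∈ L, z.1 = 0 → polar q₂ z.2 l.2 = 0 := by
    intro z hz l hl h0
    have h1 := h _ (L.add_mem hz hl)
    have h2 := h _ hz
    rw [Prod.fst_add, Prod.snd_add, h0, zero_add, h _ hl] at h1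
    rw [h0, map_zero] at h2
    rw [polar, ← h1, ← h2, sub_zero, sub_self]
  have hpol' : ∀ z ∈ L', ∀ l ∈ L', z.2 = 0 → polar q₂ z.1 l.1 = 0 := by
    intro z hz l hl h0
    have h1 := h' _ (L'.add_mem hz hl)
    have h2 := h' _ hz
    rw [Prod.fst_add, Prod.snd_add, h0, zero_add, ← h' _ hl] at h1
    rw [h0, map_zero] at h2
    rw [polar, h1, h2, sub_zero, sub_self]
  let b : L × L' →ₗ[F] V₂ := LinearMap.snd F V₁ V₂ ∘ₗ L.subtype ∘ₗ LinearMap.fst F L L'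
  let δ : L × L' →ₗ[F] V₂ :=
    b - LinearMap.fst F V₂ V₃ ∘ₗ L'.subtype ∘ₗ LinearMap.snd F L L'
  let π : L × L' →ₗ[F] V₁ × V₃ := LinearMap.prod
    (LinearMap.fst F V₁ V₂ ∘ₗ L.subtype ∘ₗ LinearMap.fst F L L')
    (LinearMap.snd F V₂ V₃ ∘ₗ L'.subtype ∘ₗ LinearMap.snd F L L')
  have hδ (x : L × L') (hx : δ x = 0) : x.1.1.2 = x.2.1.1 := sub_eq_zero.1 hx
  have d := finrank_le_finrank_add_finrank_map_ker hq b δ π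
    (fun x hx hx' hb => by
      obtain ⟨h1, h2⟩ := Prod.ext_iff.1 hx'
      have hb : x.1.1.2 = 0 := hb
      ext
      · exact h1
      · exact hb
      · exact (hδ x hx).symm.trans hb
      · exact h2)
    (fun x y hy hy' => by
      obtain ⟨h1, h2⟩ := Prod.ext_iff.1 hy'
      change polar q₂ y.1.1.2 (x.1.1.2 - x.2.1.1) = 0
      rw [polar_sub_right, hpol _ y.1.2 _ x.1.2 h1, hδ y hy, hpol' _ y.2.2 _ x.2.2 h2, sub_zero])
  rw [finrank_prod] at d
  refine ⟨(LinearMap.ker δ).map π, by omega, ?_⟩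
  rintro _ ⟨x, hx, rfl⟩
  calc q₁ x.1.1.1 = q₂ x.1.1.2 := h _ x.1.2
    _ = q₂ x.2.1.1 := by rw [hδ x hx]
    _ = q₃ x.2.1.2 := h' _ x.2.2

theorem WittRel.prod {q₁ : QuadraticForm F V₁} {q₂ : QuadraticForm F V₂}
    {q₃ : QuadraticForm F V₃} {q₄ : QuadraticForm F V₄}
    [FiniteDimensional F V₁] [FiniteDimensional F V₂] [FiniteDimensional F V₃]
    [FiniteDimensional F V₄]
    (h₁ : WittRel q₁ q₂) (h₂ : WittRel q₃ q₄) :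
    WittRel (QuadraticMap.prod q₁ q₃) (QuadraticMap.prod q₂ q₄) := by
  obtain ⟨L, hL, h⟩ := h₁
  obtain ⟨L', hL', h'⟩ := h₂
  refine .of_injective ((LinearEquiv.prodProdProdComm F V₁ V₂ V₃ V₄).toLinearMap ∘ₗ
    L.subtype.prodMap L'.subtype) ((LinearEquiv.prodProdProdComm F V₁ V₂ V₃ V₄).injective.comp
      (Prod.map_injective.2 ⟨L.subtype_injective, L'.subtype_injective⟩)) ?_ ?_
  · simp only [finrank_prod]
    omega
  · rintro ⟨x, y⟩
    exact congrArg₂ (· + ·) (h _ x.2) (h' _ y.2)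

/-- Moving a summand to the other side (in characteristic two no sign appears). -/
theorem WittRel.prod_of_prod_left [CharP F 2] {q₁ : QuadraticForm F V₁} {q₂ : QuadraticForm F V₂}
    {q₃ : QuadraticForm F V₃}
    [FiniteDimensional F V₁] [FiniteDimensional F V₂] [FiniteDimensional F V₃]
    (h : WittRel q₁ (QuadraticMap.prod q₂ q₃)) : WittRel q₃ (QuadraticMap.prod q₂ q₁) := by
  obtain ⟨L, hL, h⟩ := h
  refine .of_injective (LinearMap.prod
    (LinearMap.snd F V₂ V₃ ∘ₗ LinearMap.snd F V₁ (V₂ × V₃) ∘ₗ L.subtype)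
    (LinearMap.prod (LinearMap.fst F V₂ V₃ ∘ₗ LinearMap.snd F V₁ (V₂ × V₃) ∘ₗ L.subtype)
      (LinearMap.fst F V₁ (V₂ × V₃) ∘ₗ L.subtype))) ?_ ?_ ?_
  · rintro ⟨⟨a, b, c⟩, hx⟩ ⟨⟨a', b', c'⟩, hy⟩ hxy
    simp only [LinearMap.prod_apply, Function.prod_apply, LinearMap.comp_apply, Prod.mk.injEq,
      LinearMap.fst_apply,
      LinearMap.snd_apply, Submodule.subtype_apply] at hxy
    simp [hxy]
  · simp only [finrank_prod] at hL ⊢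
    omega
  · rintro ⟨⟨a, b, c⟩, hx⟩
    have := h _ hx
    simp only [QuadraticMap.prod_apply] at this
    change q₃ c = q₂ b + q₁ a
    rw [this, ← add_assoc, CharTwo.add_self_eq_zero, zero_add]

theorem QIsometric.of_wittRel [FiniteDimensional F V₁] [FiniteDimensional F V₂]
    {q₁ : QuadraticForm F V₁} {q₂ : QuadraticForm F V₂} (h₁ : q₁.Anisotropic)
    (h₂ : q₂.Anisotropic) (h : WittRel q₁ q₂) : QIsometric F q₁ q₂ := by
  obtain ⟨L, hL, h⟩ := h
  let f₁ : L →ₗ[F] V₁ := LinearMap.fst F V₁ V₂ ∘ₗ L.subtype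
  let f₂ : L →ₗ[F] V₂ := LinearMap.snd F V₁ V₂ ∘ₗ L.subtype
  have i₁ : Function.Injective f₁ := by
    rw [← LinearMap.ker_eq_bot, LinearMap.ker_eq_bot']
    intro x hx
    have hx : x.1.1 = 0 := hx
    have := h _ x.2
    rw [hx, map_zero] at this
    exact Subtype.ext (Prod.ext hx (h₂ _ this.symm))
  have i₂ : Function.Injective f₂ := by
    rw [← LinearMap.ker_eq_bot, LinearMap.ker_eq_bot']
    intro x hx
    have hx : x.1.2 = 0 := hx
    have := h _ x.2
    rw [hx, map_zero] at this
    exact Subtype.ext (Prod.ext (h₁ _ this) hx)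
  have d₁ := LinearMap.finrank_le_finrank_of_injective i₁
  have d₂ := LinearMap.finrank_le_finrank_of_injective i₂
  let e₁ := LinearEquiv.ofInjectiveOfFinrankEq f₁ i₁ (by omega)
  let e₂ := LinearEquiv.ofInjectiveOfFinrankEq f₂ i₂ (by omega)
  refine ⟨⟨e₁.symm.trans e₂, fun x => ?_⟩⟩
  obtain ⟨y, rfl⟩ := e₁.surjective x
  change q₂ (e₂ (e₁.symm (e₁ y))) = q₁ (e₁ y)
  rw [e₁.symm_apply_apply]
  exact (h _ y.2).symm

end WittRel

section Isometries

variable {V V₁ V₂ V₃ V₄ : Type}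
  [AddCommGroup V] [Module F V] [AddCommGroup V₁] [Module F V₁] [AddCommGroup V₂] [Module F V₂]
  [AddCommGroup V₃] [Module F V₃] [AddCommGroup V₄] [Module F V₄]

theorem QIsometric.refl (q : QuadraticForm F V) : QIsometric F q q :=
  ⟨.refl q⟩

theorem QIsometric.symm {q₁ : QuadraticForm F V₁} {q₂ : QuadraticForm F V₂}
    (h : QIsometric F q₁ q₂) : QIsometric F q₂ q₁ :=
  h.map QuadraticMap.IsometryEquiv.symm

theorem QIsometric.trans {q₁ : QuadraticForm F V₁} {q₂ : QuadraticForm F V₂}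
    {q₃ : QuadraticForm F V₃} (h : QIsometric F q₁ q₂) (h' : QIsometric F q₂ q₃) :
    QIsometric F q₁ q₃ :=
  h.elim fun e => h'.map e.trans

theorem QIsometric.prod {q₁ : QuadraticForm F V₁} {q₂ : QuadraticForm F V₂}
    {q₃ : QuadraticForm F V₃} {q₄ : QuadraticForm F V₄} (h : QIsometric F q₁ q₂)
    (h' : QIsometric F q₃ q₄) :
    QIsometric F (QuadraticMap.prod q₁ q₃) (QuadraticMap.prod q₂ q₄) :=
  h.elim fun e => h'.map e.prod

theorem QIsometric.prodAssoc (q₁ : QuadraticForm F V₁) (q₂ : QuadraticForm F V₂)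
    (q₃ : QuadraticForm F V₃) :
    QIsometric F (QuadraticMap.prod (QuadraticMap.prod q₁ q₂) q₃)
      (QuadraticMap.prod q₁ (QuadraticMap.prod q₂ q₃)) :=
  ⟨⟨LinearEquiv.prodAssoc F V₁ V₂ V₃, fun x => (add_assoc (q₁ x.1.1) (q₂ x.1.2) (q₃ x.2)).symm⟩⟩

theorem QIsometric.prod_swap_left (q₁ : QuadraticForm F V₁) (q₂ : QuadraticForm F V₂)
    (q₃ : QuadraticForm F V₃) :
    QIsometric F (QuadraticMap.prod q₁ (QuadraticMap.prod q₂ q₃))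
      (QuadraticMap.prod q₂ (QuadraticMap.prod q₁ q₃)) :=
  (QIsometric.symm (.prodAssoc q₁ q₂ q₃)).trans
    ((QIsometric.prod ⟨.prodComm q₁ q₂⟩ (.refl q₃)).trans (.prodAssoc q₂ q₁ q₃))

theorem QIsometric.zero_prod [Unique V₁] (q₁ : QuadraticForm F V₁) (q : QuadraticForm F V) :
    QIsometric F (QuadraticMap.prod q₁ q) q :=
  ⟨⟨LinearEquiv.uniqueProd, fun x => by
    rw [QuadraticMap.prod_apply, Subsingleton.elim x.1 0, map_zero, zero_add]; rfl⟩⟩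

theorem QIsometric.prod_zero [Unique V₁] (q₁ : QuadraticForm F V₁) (q : QuadraticForm F V) :
    QIsometric F (QuadraticMap.prod q q₁) q :=
  (QIsometric.trans ⟨.prodComm q q₁⟩ (.zero_prod q₁ q))

theorem QIsometric.pi_succ {k : ℕ} (q : Fin (k + 1) → QuadraticForm F V) :
    QIsometric F (QuadraticMap.pi q)
      (QuadraticMap.prod (q 0) (QuadraticMap.pi fun i => q (Fin.succ i))) :=
  QIsometric.symm ⟨⟨Fin.consLinearEquiv F fun _ => V, fun x => by
    simp [Fin.sum_univ_succ]⟩⟩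

theorem QIsometric.of_oSum {m n : ℕ} (q₁ : QF F m) (q₂ : QF F n) :
    QIsometric F (oSum F q₁ q₂) (QuadraticMap.prod q₁ q₂) :=
  QIsometric.symm ⟨isometryEquivOfCompLinearEquiv (QuadraticMap.prod q₁ q₂)
    ((LinearEquiv.funCongrLeft F F finSumFinEquiv).trans
      (LinearEquiv.sumArrowLequivProdArrow (Fin m) (Fin n) F F))⟩

theorem QIsometric.of_oSumFam {k n : ℕ} (q : Fin k → QF F n) :
    QIsometric F (oSumFam F q) (QuadraticMap.pi q) :=
  QIsometric.symm ⟨isometryEquivOfCompLinearEquiv (QuadraticMap.pi q)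
    ((LinearEquiv.funCongrLeft F F finProdFinEquiv).trans
      (LinearEquiv.curry F F (Fin k) (Fin n)))⟩

theorem Nonsingular.of_isometric {q₁ : QuadraticForm F V₁} {q₂ : QuadraticForm F V₂}
    (h : QIsometric F q₁ q₂) (h₁ : Nonsingular F q₁) : Nonsingular F q₂ := by
  obtain ⟨e⟩ := h
  intro x hx
  obtain ⟨x, rfl⟩ := e.toLinearEquiv.surjective x
  rw [h₁ x, map_zero]
  intro y
  have := hx (e y)
  change polar q₂ (e x) (e y) = 0 at this
  simpa only [polar, ← map_add, e.map_app] using this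

theorem Nonsingular.prod {q₁ : QuadraticForm F V₁} {q₂ : QuadraticForm F V₂}
    (h₁ : Nonsingular F q₁) (h₂ : Nonsingular F q₂) :
    Nonsingular F (QuadraticMap.prod q₁ q₂) := by
  rintro ⟨x, y⟩ h
  ext
  · exact h₁ _ fun z => by simpa using h (z, 0)
  · exact h₂ _ fun z => by simpa using h (0, z)

theorem Nonsingular.of_prod_right {q₁ : QuadraticForm F V₁} {q₂ : QuadraticForm F V₂}
    (h : Nonsingular F (QuadraticMap.prod q₁ q₂)) : Nonsingular F q₂ := by
  intro x hx
  have := h (0, x) fun y => by simp [hx]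
  exact (Prod.ext_iff.1 this).2

theorem Nonsingular.of_prod_left {q₁ : QuadraticForm F V₁} {q₂ : QuadraticForm F V₂}
    (h : Nonsingular F (QuadraticMap.prod q₁ q₂)) : Nonsingular F q₁ :=
  Nonsingular.of_prod_right (.of_isometric ⟨.prodComm q₁ q₂⟩ h)

theorem Nonsingular.pi {k : ℕ} {q : Fin k → QuadraticForm F V} (h : ∀ i, Nonsingular F (q i)) :
    Nonsingular F (QuadraticMap.pi q) := by
  intro x hx
  ext i
  refine h i _ fun y => ?_
  have := hx (Pi.single i y)
  rw [Ring.polar_pi, Finset.sum_eq_single i] at this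
  · simpa using this
  · intro j _ hj
    simp [Pi.single_eq_of_ne hj]
  · simp

theorem binQF_apply (a b : F) (z : Fin 2 → F) :
    binQF F a b z = a * z 0 ^ 2 + z 0 * z 1 + b * z 1 ^ 2 := by
  rw [binQF, Matrix.toQuadraticMap', Matrix.toQuadraticForm',
    LinearMap.BilinMap.toQuadraticMap_apply,
    Matrix.toLinearMap₂'_apply]
  simp [Fin.sum_univ_two]
  ring

theorem polar_binQF [CharP F 2] (a b : F) (z w : Fin 2 → F) :
    polar (binQF F a b) z w = z 0 * w 1 + z 1 * w 0 := by
  simp only [polar, binQF_apply, Pi.add_apply]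
  linear_combination (a * z 0 * w 0 + b * z 1 * w 1) * CharTwo.two_eq_zero (R := F)

theorem nonsingular_smul_binQF [CharP F 2] {c : F} (hc : c ≠ 0) (a b : F) :
    Nonsingular F (c • binQF F a b) := by
  intro x hx
  have h0 := hx (Pi.single 1 1)
  have h1 := hx (Pi.single 0 1)
  rw [FunLike.coe_smul, polar_smul, polar_binQF] at h0 h1
  ext i
  fin_cases i <;> simp_all

theorem nonsingular_binQF [CharP F 2] (a b : F) : Nonsingular F (binQF F a b) := by
  simpa using nonsingular_smul_binQF (one_ne_zero (α := F)) a b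

theorem polar_self_eq_zero [CharP F 2] (q : QuadraticForm F V) (x : V) : polar q x x = 0 := by
  rw [polar_self, two_nsmul, CharTwo.add_self_eq_zero]

/-- Splitting off the nonsingular plane spanned by `x` and `y`. -/
theorem exists_isometric_prod [CharP F 2] {q : QuadraticForm F V}
    (hq : Nonsingular F q) (x y : V) {c : F} (hc : c ≠ 0) (hxy : polar q x y = c) (β : QF F 2)
    (hβ : ∀ z, β z = z 0 ^ 2 * q x + z 0 * z 1 * c + z 1 ^ 2 * q y) :
    ∃ W : Submodule F V, Nonsingular F (q.comp W.subtype) ∧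
      QIsometric F q (QuadraticMap.prod β (q.comp W.subtype)) ∧
      ∀ w, w ∈ W ↔ polar q w x = 0 ∧ polar q w y = 0 := by
  have hyx : polar q y x = c := by rw [polar_comm, hxy]
  let W : Submodule F V := LinearMap.ker (q.polarBilin.flip x) ⊓ LinearMap.ker (q.polarBilin.flip y)
  have hW (w : V) : w ∈ W ↔ polar q w x = 0 ∧ polar q w y = 0 := Iff.rfl
  let f : (Fin 2 → F) × W →ₗ[F] V :=
    { toFun := fun z => z.1 0 • x + z.1 1 • y + z.2
      map_add' := fun a b => by
        simp only [Prod.fst_add, Prod.snd_add, Pi.add_apply, Submodule.coe_add]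
        module
      map_smul' := fun a b => by
        simp only [Prod.smul_fst, Prod.smul_snd, Pi.smul_apply, Submodule.coe_smul, smul_eq_mul,
          RingHom.id_apply]
        module }
  have hf (z) : f z = z.1 0 • x + z.1 1 • y + z.2 := rfl
  have hpy (z) : polar q (f z) y = z.1 0 * c := by
    rw [hf, polar_add_left, polar_add_left, polar_smul_left, polar_smul_left, hxy,
      polar_self_eq_zero, ((hW _).1 z.2.2).2]
    simp
  have hpx (z) : polar q (f z) x = z.1 1 * c := by
    rw [hf, polar_add_left, polar_add_left, polar_smul_left, polar_smul_left, hyx,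
      polar_self_eq_zero, ((hW _).1 z.2.2).1]
    simp
  have hinj : Function.Injective f := by
    rw [← LinearMap.ker_eq_bot, LinearMap.ker_eq_bot']
    intro z hz
    have h0 : z.1 0 = 0 := by simpa [hz, hc] using hpy z
    have h1 : z.1 1 = 0 := by simpa [hz, hc] using hpx z
    rw [hf, h0, h1] at hz
    refine Prod.ext (funext fun i => ?_) (Subtype.ext (by simpa using hz))
    fin_cases i
    exacts [h0, h1]
  have hsurj : Function.Surjective f := by
    intro v
    refine ⟨(![polar q v y / c, polar q v x / c],
      ⟨v - (polar q v y / c) • x - (polar q v x / c) • y, (hW _).2 ⟨?_, ?_⟩⟩), ?_⟩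
    · rw [polar_sub_left, polar_sub_left, polar_smul_left, polar_smul_left, hyx,
        polar_self_eq_zero]
      simp [hc]
    · rw [polar_sub_left, polar_sub_left, polar_smul_left, polar_smul_left, hxy,
        polar_self_eq_zero]
      simp [hc]
    · rw [hf]
      simp only [Matrix.cons_val_zero, Matrix.cons_val_one]
      module
  let e := LinearEquiv.ofBijective f ⟨hinj, hsurj⟩
  have hiso : QIsometric F q (QuadraticMap.prod β (q.comp W.subtype)) := by
    refine QIsometric.symm ⟨⟨e, fun z => ?_⟩⟩
    change q (z.1 0 • x + z.1 1 • y + z.2) = β z.1 + q z.2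
    have hz := (hW _).1 z.2.2
    rw [QuadraticMap.map_add q, QuadraticMap.map_add q, QuadraticMap.map_smul,
      QuadraticMap.map_smul, polar_smul_left, polar_smul_right, hxy, polar_add_left,
      polar_smul_left, polar_smul_left, polar_comm q x, polar_comm q y, hz.1, hz.2, hβ]
    simp only [smul_eq_mul]
    ring
  exact ⟨W, Nonsingular.of_prod_right (.of_isometric hiso hq), hiso, hW⟩

theorem finrank_add_two_eq [FiniteDimensional F V] [FiniteDimensional F V₁]
    {q : QuadraticForm F V} {β : QF F 2} {q₁ : QuadraticForm F V₁}
    (h : QIsometric F q (QuadraticMap.prod β q₁)) : finrank F V₁ + 2 = finrank F V := by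
  obtain ⟨e⟩ := h
  rw [e.toLinearEquiv.finrank_eq, finrank_prod, finrank_fin_fun, add_comm]

/-- Splitting off a hyperbolic plane containing a given isotropic vector. -/
theorem exists_isometric_hyperbolic_prod [CharP F 2] {q : QuadraticForm F V}
    (hq : Nonsingular F q) {x : V} (hx : x ≠ 0) (hqx : q x = 0) :
    ∃ W : Submodule F V, Nonsingular F (q.comp W.subtype) ∧
      QIsometric F q (QuadraticMap.prod (binQF F 0 0) (q.comp W.subtype)) := by
  obtain ⟨y, hy⟩ : ∃ y, polar q x y ≠ 0 := by
    by_contra! h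
    exact hx (hq x h)
  obtain ⟨y, hy⟩ : ∃ y, polar q x y = 1 :=
    ⟨(polar q x y)⁻¹ • y, by rw [polar_smul_right, smul_eq_mul, inv_mul_cancel₀ hy]⟩
  have hy' : polar q x (y + q y • x) = 1 := by
    rw [polar_add_right, polar_smul_right, hy, polar_self_eq_zero, smul_zero, add_zero]
  have hqy : q (y + q y • x) = 0 := by
    rw [QuadraticMap.map_add q, QuadraticMap.map_smul, hqx, polar_smul_right, polar_comm, hy,
      smul_zero, add_zero, smul_eq_mul, mul_one, CharTwo.add_self_eq_zero]
  obtain ⟨W, h, h', -⟩ := exists_isometric_prod hq x _ one_ne_zero hy' (binQF F 0 0)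
    fun z => by rw [binQF_apply, hqx, hqy]; ring
  exact ⟨W, h, h'⟩

theorem exists_isometric_fin [FiniteDimensional F V] (q : QuadraticForm F V) :
    ∃ ρ : QF F (finrank F V), QIsometric F q ρ :=
  ⟨_, ⟨isometryEquivOfCompLinearEquiv q (finBasis F V).equivFun.symm⟩⟩

theorem anisotropic_of_isometric {q₁ : QuadraticForm F V₁} {q₂ : QuadraticForm F V₂}
    (h : QIsometric F q₁ q₂) (h₁ : q₁.Anisotropic) : q₂.Anisotropic := by
  obtain ⟨e⟩ := h
  intro x hx
  rw [← e.apply_symm_apply x, e.map_app] at hx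
  rw [← e.apply_symm_apply x, h₁ _ hx]
  exact map_zero e.toLinearEquiv

theorem exists_witt_decomposition [CharP F 2] (n : ℕ) (V : Type) [AddCommGroup V] [Module F V]
    [FiniteDimensional F V] (hn : finrank F V = n) (q : QuadraticForm F V)
    (hq : Nonsingular F q) :
    ∃ (i r : ℕ) (ρ : QF F r), ρ.Anisotropic ∧
      QIsometric F q (QuadraticMap.prod (QuadraticMap.pi fun _ : Fin i => binQF F 0 0) ρ) := by
  induction n using Nat.strong_induction_on generalizing V with
  | _ n ih =>
  by_cases ha : q.Anisotropic
  · obtain ⟨ρ, hρ⟩ := exists_isometric_fin q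
    exact ⟨0, _, ρ, anisotropic_of_isometric hρ ha, hρ.trans (.symm (.zero_prod _ ρ))⟩
  · obtain ⟨x, hqx, hx⟩ : ∃ x, q x = 0 ∧ x ≠ 0 := by
      simpa [QuadraticMap.Anisotropic] using ha
    obtain ⟨W, hW, hiso⟩ := exists_isometric_hyperbolic_prod hq hx hqx
    have := finrank_add_two_eq hiso
    obtain ⟨i, r, ρ, hρ, h⟩ := ih _ (by omega) W rfl _ hW
    exact ⟨i + 1, r, ρ, hρ, hiso.trans (((QIsometric.refl _).prod h).trans
      ((QIsometric.symm (.prodAssoc _ _ _)).trans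
        (.prod (.symm (.pi_succ fun _ : Fin (i + 1) => binQF F 0 0)) (.refl ρ))))⟩

end Isometries

section WittEquiv

variable {V V₁ V₂ : Type} [AddCommGroup V] [Module F V] [AddCommGroup V₁] [Module F V₁]
  [AddCommGroup V₂] [Module F V₂]

theorem wittRel_pi_hyperbolic (i : ℕ) :
    WittRel (QuadraticMap.pi fun _ : Fin i => binQF F 0 0) (0 : QF F 0) := by
  refine .of_injective (V := Fin i → F)
    (LinearMap.inl F _ _ ∘ₗ LinearMap.pi fun k => LinearMap.single F (fun _ => F) 0 ∘ₗ
      LinearMap.proj k) ?_ ?_ ?_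
  · refine LinearMap.inl_injective.comp fun x y h => funext fun k => ?_
    simpa using congrFun (congrFun h k) 0
  · simp [finrank_pi_fintype, two_mul, mul_two]
  · intro x
    simp [binQF_apply]

theorem wittRel_diagQF_zero (j : ℕ) : WittRel (diagQF F (0 : Fin j → F)) (0 : QF F 0) := by
  refine .of_injective (LinearMap.inl F _ _) LinearMap.inl_injective ?_ ?_
  · simp [two_mul]
  · intro x
    simp [diagQF]

theorem isometric_oSum_hyperbolic (i j : ℕ) {r : ℕ} (ρ : QF F r) :
    QIsometric F
      (oSum F (oSum F (oSumFam F fun _ : Fin i => binQF F 0 0) ρ) (diagQF F (0 : Fin j → F)))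
      (QuadraticMap.prod (QuadraticMap.prod (QuadraticMap.pi fun _ : Fin i => binQF F 0 0) ρ)
        (diagQF F (0 : Fin j → F))) :=
  (QIsometric.of_oSum _ _).trans
    (.prod ((QIsometric.of_oSum _ _).trans (.prod (.of_oSumFam _) (.refl ρ))) (.refl _))

theorem wittRel_oSum_hyperbolic (i j : ℕ) {r : ℕ} (ρ : QF F r) :
    WittRel (QuadraticMap.prod (QuadraticMap.prod
      (QuadraticMap.pi fun _ : Fin i => binQF F 0 0) ρ) (diagQF F (0 : Fin j → F))) ρ := by
  obtain ⟨L, hL, h⟩ := ((wittRel_pi_hyperbolic i).prod (.refl ρ)).prod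
    (wittRel_diagQF_zero (F := F) j)
  let e : (((Fin 0 → F) × (Fin r → F)) × (Fin 0 → F)) ≃ₗ[F] (Fin r → F) :=
    LinearEquiv.prodUnique.trans LinearEquiv.uniqueProd
  refine .of_injective ((LinearMap.id.prodMap e.toLinearMap) ∘ₗ L.subtype)
    ((Prod.map_injective.2 ⟨Function.injective_id, e.injective⟩).comp L.subtype_injective) ?_ ?_
  · simpa using hL
  · intro x
    refine (h _ x.2).trans ?_
    simp [e]

theorem WittRel.of_wittEquiv [FiniteDimensional F V₁] [FiniteDimensional F V₂]
    {q₁ : QuadraticForm F V₁} {q₂ : QuadraticForm F V₂} (hq : Nonsingular F q₂)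
    (h : WittEquiv F q₁ q₂) : WittRel q₁ q₂ := by
  obtain ⟨r, ρ, -, ⟨i, j, h₁⟩, ⟨i', j', h₂⟩⟩ := h
  have h₁ := h₁.trans (isometric_oSum_hyperbolic i j ρ)
  have h₂ := h₂.trans (isometric_oSum_hyperbolic i' j' ρ)
  have hn := Nonsingular.of_isometric h₂ hq
  have hρ : Nonsingular F ρ := .of_prod_right (.of_prod_left hn)
  have w₂ := (WittRel.of_isometric h₂).trans hn (wittRel_oSum_hyperbolic i' j' ρ)
  have w₁ := (wittRel_oSum_hyperbolic i j ρ).of_isometric_left h₁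
  exact w₁.trans hρ w₂.symm

theorem WittRel.wittEquiv [CharP F 2] [FiniteDimensional F V₁] [FiniteDimensional F V₂]
    {q₁ : QuadraticForm F V₁} {q₂ : QuadraticForm F V₂} (h₁ : Nonsingular F q₁)
    (h₂ : Nonsingular F q₂) (h : WittRel q₁ q₂) : WittEquiv F q₁ q₂ := by
  obtain ⟨i, r, ρ, hρ, e₁⟩ := exists_witt_decomposition _ V₁ rfl q₁ h₁
  obtain ⟨i', r', ρ', hρ', e₂⟩ := exists_witt_decomposition _ V₂ rfl q₂ h₂
  have add_zero {i r : ℕ} (ρ : QF F r) := (QIsometric.prod_zero (diagQF F (0 : Fin 0 → F))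
    (QuadraticMap.prod (QuadraticMap.pi fun _ : Fin i => binQF F 0 0) ρ)).symm.trans
      (isometric_oSum_hyperbolic i 0 ρ).symm
  have key {i r : ℕ} {V : Type} [AddCommGroup V] [Module F V]
      {q : QuadraticForm F V} {ρ : QF F r} (e : QIsometric F q
        (QuadraticMap.prod (QuadraticMap.pi fun _ : Fin i => binQF F 0 0) ρ)) : WittRel q ρ :=
    (wittRel_oSum_hyperbolic i 0 ρ).of_isometric_left (e.trans (.symm (.prod_zero _ _)))
  have hiso : QIsometric F ρ ρ' :=
    .of_wittRel hρ hρ' (((key e₁).symm.trans h₁ h).trans h₂ (key e₂))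
  exact ⟨r, ρ, hρ, ⟨i, 0, e₁.trans (add_zero ρ)⟩,
    ⟨i', 0, (e₂.trans (.prod (.refl _) hiso.symm)).trans (add_zero ρ)⟩⟩

end WittEquiv

section ScalarExtension

open scoped TensorProduct

variable (E : Type) [Field E] [Algebra F E]
  {V V₁ V₂ : Type} [AddCommGroup V] [Module F V] [AddCommGroup V₁] [Module F V₁]
  [AddCommGroup V₂] [Module F V₂]

/-- Scalar extension of a quadratic form on an arbitrary space (in any characteristic). -/
noncomputable def scalarExt (q : QuadraticForm F V) : QuadraticForm E (E ⊗[F] V) :=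
  (LinearMap.BilinForm.baseChange E
    (LinearMap.BilinMap.toQuadraticMap_surjective q).choose).toQuadraticMap

theorem scalarExt_tmul (q : QuadraticForm F V) (a : E) (x : V) :
    scalarExt E q (a ⊗ₜ x) = a ^ 2 * algebraMap F E (q x) := by
  conv_rhs => rw [← (LinearMap.BilinMap.toQuadraticMap_surjective q).choose_spec]
  rw [scalarExt, LinearMap.BilinMap.toQuadraticMap_apply, LinearMap.BilinForm.baseChange_tmul,
    LinearMap.BilinMap.toQuadraticMap_apply, Algebra.smul_def]
  ring

theorem polar_scalarExt_tmul (q : QuadraticForm F V) (a b : E) (x y : V) :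
    polar (scalarExt E q) (a ⊗ₜ x) (b ⊗ₜ y) = a * b * algebraMap F E (polar q x y) := by
  conv_rhs => rw [← (LinearMap.BilinMap.toQuadraticMap_surjective q).choose_spec]
  rw [scalarExt, LinearMap.BilinMap.polar_toQuadraticMap, LinearMap.BilinForm.baseChange_tmul,
    LinearMap.BilinForm.baseChange_tmul, LinearMap.BilinMap.polar_toQuadraticMap, map_add,
    Algebra.smul_def, Algebra.smul_def]
  ring

theorem WittRel.scalarExt [FiniteDimensional F V₁] [FiniteDimensional F V₂]
    {q₁ : QuadraticForm F V₁} {q₂ : QuadraticForm F V₂}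
    (h : WittRel q₁ q₂) : WittRel (scalarExt E q₁) (scalarExt E q₂) := by
  obtain ⟨L, hL, h⟩ := h
  let f : E ⊗[F] L →ₗ[E] (E ⊗[F] V₁) × (E ⊗[F] V₂) :=
    (TensorProduct.prodRight F E E V₁ V₂).toLinearMap ∘ₗ L.subtype.baseChange E
  refine .of_injective f ((TensorProduct.prodRight F E E V₁ V₂).injective.comp
    (Module.Flat.lTensor_preserves_injective_linearMap _ L.subtype_injective)) ?_ fun x => ?_
  · simpa only [finrank_baseChange] using hL
  · have : (_root_.scalarExt E q₁).comp (LinearMap.fst E _ _ ∘ₗ f)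
        = (_root_.scalarExt E q₂).comp (LinearMap.snd E _ _ ∘ₗ f) := by
      refine baseChange_ext fun m => ?_
      simp [f, scalarExt_tmul, h _ m.2]
    exact congrArg (fun q => q x) this

theorem QIsometric.scalarExt {q₁ : QuadraticForm F V₁} {q₂ : QuadraticForm F V₂}
    (h : QIsometric F q₁ q₂) : QIsometric E (scalarExt E q₁) (scalarExt E q₂) := by
  obtain ⟨e⟩ := h
  refine ⟨⟨e.toLinearEquiv.baseChange F E V₁ V₂, fun x => ?_⟩⟩
  have : (_root_.scalarExt E q₂).comp (e.toLinearEquiv.baseChange F E V₁ V₂).toLinearMap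
      = _root_.scalarExt E q₁ := by
    refine baseChange_ext fun m => ?_
    rw [QuadraticMap.comp_apply, LinearEquiv.coe_coe, LinearEquiv.baseChange_tmul,
      scalarExt_tmul, scalarExt_tmul]
    exact congrArg (fun c => 1 ^ 2 * algebraMap F E c) (e.map_app m)
  exact congrArg (fun q => q x) this

theorem isometric_scalarExt_prod (q₁ : QuadraticForm F V₁) (q₂ : QuadraticForm F V₂) :
    QIsometric E (scalarExt E (QuadraticMap.prod q₁ q₂))
      (QuadraticMap.prod (scalarExt E q₁) (scalarExt E q₂)) := by
  refine ⟨⟨TensorProduct.prodRight F E E V₁ V₂, fun x => ?_⟩⟩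
  have : (QuadraticMap.prod (scalarExt E q₁) (scalarExt E q₂)).comp
      (TensorProduct.prodRight F E E V₁ V₂).toLinearMap
      = scalarExt E (QuadraticMap.prod q₁ q₂) := by
    refine baseChange_ext fun m => ?_
    rw [QuadraticMap.comp_apply, LinearEquiv.coe_coe, TensorProduct.prodRight_tmul,
      QuadraticMap.prod_apply, scalarExt_tmul, scalarExt_tmul, scalarExt_tmul,
      QuadraticMap.prod_apply, map_add, mul_add]
  exact congrArg (fun q => q x) this

theorem toQuadraticForm'_qMat {n : ℕ} (q : QF F n) : (qMat F q).toQuadraticForm' = q := by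
  conv_rhs => rw [← toQuadraticMap_toBilin q (Pi.basisFun F (Fin n))]
  rw [Matrix.toQuadraticForm']
  congr 1
  refine LinearMap.ext_basis (Pi.basisFun F (Fin n)) (Pi.basisFun F (Fin n)) fun i j => ?_
  rw [toBilin_apply, Pi.basisFun_apply, Pi.basisFun_apply]
  rw [Matrix.toLinearMap₂'_apply]
  have (M : Matrix (Fin n) (Fin n) F) : ∑ k, ∑ l, (Pi.single i 1 : Fin n → F) k •
      (Pi.single j 1 : Fin n → F) l • M k l = M i j := by simp [Pi.single_apply]
  exact this _

theorem extQF_algebraMap {n : ℕ} (q : QF F n) (x : Fin n → F) :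
    extQF F E q (fun i => algebraMap F E (x i)) = algebraMap F E (q x) := by
  conv_rhs => rw [← toQuadraticForm'_qMat q]
  rw [extQF, Matrix.toQuadraticMap', Matrix.toQuadraticForm', Matrix.toQuadraticForm',
    LinearMap.BilinMap.toQuadraticMap_apply, LinearMap.BilinMap.toQuadraticMap_apply,
    Matrix.toLinearMap₂'_apply, Matrix.toLinearMap₂'_apply]
  simp

theorem isometric_scalarExt_extQF {n : ℕ} (q : QF F n) :
    QIsometric E (scalarExt E q) (extQF F E q) := by
  refine ⟨⟨TensorProduct.piScalarRight F E E (Fin n), fun x => ?_⟩⟩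
  have : (extQF F E q).comp (TensorProduct.piScalarRight F E E (Fin n)).toLinearMap
      = scalarExt E q := by
    refine baseChange_ext fun m => ?_
    have := extQF_algebraMap E q m
    simpa [scalarExt_tmul, Algebra.algebraMap_eq_smul_one] using this
  exact congrArg (fun q => q x) this

variable {E}

/-- Coordinates of an element of a scalar extension with respect to a basis of the field
extension. -/
noncomputable def tensorCoord {ι : Type} [Fintype ι] [DecidableEq ι] (b : Basis ι F E) (V : Type)
    [AddCommGroup V] [Module F V] : E ⊗[F] V ≃ₗ[F] (ι → V) :=
  (TensorProduct.equivFinsuppOfBasisLeft b).trans (Finsupp.linearEquivFunOnFinite F V ι)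

theorem sum_tensorCoord {ι : Type} [Fintype ι] [DecidableEq ι] (b : Basis ι F E)
    (x : E ⊗[F] V) : ∑ i, b i ⊗ₜ[F] tensorCoord b V x i = x := by
  conv_rhs => rw [← (TensorProduct.equivFinsuppOfBasisLeft b).symm_apply_apply x,
    TensorProduct.equivFinsuppOfBasisLeft_symm_apply]
  rw [Finsupp.sum_fintype _ _ fun i => TensorProduct.tmul_zero _ _]
  rfl

theorem Nonsingular.scalarExt [FiniteDimensional F E] {q : QuadraticForm F V}
    (h : Nonsingular F q) : Nonsingular E (scalarExt E q) := by
  intro x hx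
  let b := finBasis F E
  have hb (i) : tensorCoord b V x i = 0 := by
    refine h _ fun y => ?_
    have := hx (1 ⊗ₜ y)
    rw [← sum_tensorCoord b x, ← polarBilin_apply_apply, map_sum, LinearMap.sum_apply] at this
    simp only [polarBilin_apply_apply, polar_scalarExt_tmul, mul_one] at this
    simp only [mul_comm (b _), ← Algebra.smul_def] at this
    exact Fintype.linearIndependent_iff.1 b.linearIndependent _ this i
  rw [← sum_tensorCoord b x]
  simp [hb]

end ScalarExtension

section Neutral

open scoped TensorProduct

variable {E : Type} [Field E] [Algebra F E]
  {V V₁ V₂ : Type} [AddCommGroup V] [Module F V] [AddCommGroup V₁] [Module F V₁]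
  [AddCommGroup V₂] [Module F V₂]

variable (E) in
/-- The scalar extension of `q` to `E` has a Lagrangian subspace. -/
def Neutral (q : QuadraticForm F V) : Prop :=
  WittRel (scalarExt E q) (0 : QF E 0)

theorem nonsingular_zero : Nonsingular F (0 : QF F 0) :=
  fun _ _ => Subsingleton.elim _ _

theorem Neutral.of_isometric [FiniteDimensional F V₁] [FiniteDimensional F V₂]
    {q₁ : QuadraticForm F V₁} {q₂ : QuadraticForm F V₂}
    (h : QIsometric F q₁ q₂) (h₁ : Neutral E q₁) : Neutral E q₂ :=
  WittRel.of_isometric_left (h.scalarExt E).symm h₁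

theorem neutral_of_finrank_eq_zero (q : QuadraticForm F V) (h : finrank F V = 0) :
    Neutral E q := by
  refine .of_injective (V := Fin 0 → E) 0 (fun x y _ => Subsingleton.elim x y) ?_ fun x => ?_
  · simp [h]
  · simp

theorem Neutral.prod [FiniteDimensional F V₁] [FiniteDimensional F V₂]
    {q₁ : QuadraticForm F V₁} {q₂ : QuadraticForm F V₂}
    (h₁ : Neutral E q₁) (h₂ : Neutral E q₂) : Neutral E (QuadraticMap.prod q₁ q₂) :=
  .of_isometric_left (isometric_scalarExt_prod E q₁ q₂) <|
    (WittRel.prod h₁ h₂).trans (nonsingular_zero.prod nonsingular_zero)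
      (.of_isometric (.zero_prod _ _))

theorem Neutral.of_prod [CharP F 2] [FiniteDimensional F E] [FiniteDimensional F V₁]
    [FiniteDimensional F V₂] {q₁ : QuadraticForm F V₁} {q₂ : QuadraticForm F V₂}
    (hq₁ : Nonsingular F q₁) (h₁ : Neutral E q₁) (h : Neutral E (QuadraticMap.prod q₁ q₂)) :
    Neutral E q₂ := by
  have := charP_of_injective_algebraMap (algebraMap F E).injective 2
  have h' : WittRel (0 : QF E 0) (QuadraticMap.prod (scalarExt E q₁) (scalarExt E q₂)) :=
    (WittRel.of_isometric_left (isometric_scalarExt_prod E q₁ q₂).symm h).symm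
  exact h'.prod_of_prod_left.trans (hq₁.scalarExt.prod nonsingular_zero)
    ((WittRel.prod h₁ (.refl _)).trans (nonsingular_zero.prod nonsingular_zero)
      (.of_isometric (.zero_prod _ _)))

theorem Neutral.of_wittRel [FiniteDimensional F E] [FiniteDimensional F V₁]
    [FiniteDimensional F V₂] {q₁ : QuadraticForm F V₁} {q₂ : QuadraticForm F V₂}
    (hq₂ : Nonsingular F q₂) (h : WittRel q₁ q₂) (h₂ : Neutral E q₂) : Neutral E q₁ :=
  (h.scalarExt E).trans hq₂.scalarExt h₂

theorem wittRel_binQF_zero_zero : WittRel (binQF F 0 0) (0 : QF F 0) :=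
  .of_injective (LinearMap.inl F _ _ ∘ₗ LinearMap.single F (fun _ => F) 0)
    (LinearMap.inl_injective.comp (Pi.single_injective (M := fun _ => F) 0))
    (by simp) fun x => by simp [binQF_apply]

theorem neutral_binQF_zero_zero [FiniteDimensional F E] : Neutral E (binQF F 0 0) :=
  .of_wittRel nonsingular_zero wittRel_binQF_zero_zero (neutral_of_finrank_eq_zero _ (by simp))

theorem neutral_smul_binQF [CharP F 2] {c u : F} {μ : E} (hc : c ≠ 0)
    (hμ : μ ^ 2 + μ + algebraMap F E u = 0) :
    Neutral E (c • binQF F 1 u) := by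
  have := charP_of_injective_algebraMap (algebraMap F E).injective 2
  let w : E ⊗[F] (Fin 2 → F) := μ ⊗ₜ Pi.single 0 1 + 1 ⊗ₜ Pi.single 1 1
  have hw : scalarExt E (c • binQF F 1 u) w = 0 := by
    rw [QuadraticMap.map_add (scalarExt E (c • binQF F 1 u)), scalarExt_tmul, scalarExt_tmul,
      polar_scalarExt_tmul, FunLike.coe_smul, polar_smul, polar_binQF, Pi.smul_apply,
      Pi.smul_apply, binQF_apply, binQF_apply]
    simp
    linear_combination algebraMap F E c * hμ
  have hw0 : w ≠ 0 := by
    intro h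
    have : polar (scalarExt E (c • binQF F 1 u)) w (1 ⊗ₜ Pi.single 0 1) = 0 := by
      rw [h, polar_zero_left]
    rw [polar_add_left, polar_scalarExt_tmul, polar_scalarExt_tmul, FunLike.coe_smul, polar_smul,
      polar_smul, polar_binQF, polar_binQF] at this
    simp [hc] at this
  refine .of_injective (LinearMap.inl E _ _ ∘ₗ LinearMap.toSpanSingleton E _ w)
    (LinearMap.inl_injective.comp (smul_left_injective E hw0)) ?_ fun x => ?_
  · simp
  · change scalarExt E (c • binQF F 1 u) (x • w) = 0
    rw [QuadraticMap.map_smul, hw, smul_zero]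

theorem Neutral.pi [FiniteDimensional F V] {k : ℕ} {q : Fin k → QuadraticForm F V}
    (h : ∀ i, Neutral E (q i)) : Neutral E (QuadraticMap.pi q) := by
  induction k with
  | zero => exact neutral_of_finrank_eq_zero _ finrank_zero_of_subsingleton
  | succ k ih => exact .of_isometric (QIsometric.pi_succ q).symm ((h 0).prod (ih fun i => h i.succ))

theorem inWqKernel_iff_neutral [CharP F 2] [FiniteDimensional F E] {n : ℕ} {q : QF F n}
    (hq : Nonsingular F q) : InWqKernel F E q ↔ Neutral E q := by
  have := charP_of_injective_algebraMap (algebraMap F E).injective 2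
  have h := isometric_scalarExt_extQF E q
  exact ⟨fun h' => .of_isometric_left h (.of_wittEquiv nonsingular_zero h'), fun h' =>
    (WittRel.of_isometric_left h.symm h').wittEquiv (.of_isometric h hq.scalarExt)
      nonsingular_zero⟩

end Neutral

section KernelForm

variable {V V₁ V₂ : Type} [AddCommGroup V] [Module F V] [AddCommGroup V₁] [Module F V₁]
  [AddCommGroup V₂] [Module F V₂]

/-- The orthogonal sum of multiples of `[1,u]` and of `[1,v]`. -/
noncomputable def kernelForm (u v : F) {k l : ℕ} (lam : Fin k → F) (mu : Fin l → F) :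
    QuadraticForm F ((Fin k → Fin 2 → F) × (Fin l → Fin 2 → F)) :=
  QuadraticMap.prod (QuadraticMap.pi fun i => lam i • binQF F 1 u)
    (QuadraticMap.pi fun i => mu i • binQF F 1 v)

theorem isometric_kernelForm (u v : F) {k l : ℕ} (lam : Fin k → F) (mu : Fin l → F) :
    QIsometric F (oSum F (oSumFam F fun i => lam i • binQF F 1 u)
      (oSumFam F fun i => mu i • binQF F 1 v)) (kernelForm u v lam mu) :=
  (QIsometric.of_oSum _ _).trans (.prod (.of_oSumFam _) (.of_oSumFam _))

theorem nonsingular_kernelForm [CharP F 2] (u v : F) {k l : ℕ} {lam : Fin k → F} {mu : Fin l → F}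
    (hlam : ∀ i, lam i ≠ 0) (hmu : ∀ i, mu i ≠ 0) : Nonsingular F (kernelForm u v lam mu) :=
  .prod (.pi fun i => nonsingular_smul_binQF (hlam i) _ _)
    (.pi fun i => nonsingular_smul_binQF (hmu i) _ _)

/-- The Witt class of `q` lies in the `WF`-submodule generated by `[1,u]` and `[1,v]`. -/
def InSpan (u v : F) (q : QuadraticForm F V) : Prop :=
  ∃ (k l : ℕ) (lam : Fin k → F) (mu : Fin l → F),
    (∀ i, lam i ≠ 0) ∧ (∀ i, mu i ≠ 0) ∧ WittRel q (kernelForm u v lam mu)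

variable {u v : F}

theorem InSpan.of_wittRel [FiniteDimensional F V₁] [FiniteDimensional F V₂]
    {q₁ : QuadraticForm F V₁} {q₂ : QuadraticForm F V₂} (hq : Nonsingular F q₂)
    (h : WittRel q₁ q₂) (h₂ : InSpan u v q₂) : InSpan u v q₁ := by
  obtain ⟨k, l, lam, mu, hlam, hmu, h'⟩ := h₂
  exact ⟨k, l, lam, mu, hlam, hmu, h.trans hq h'⟩

theorem inSpan_of_finrank_eq_zero (q : QuadraticForm F V) (h : finrank F V = 0) :
    InSpan u v q := by
  refine ⟨0, 0, 0, 0, fun i => i.elim0, fun i => i.elim0, ?_⟩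
  refine .of_injective (V := Fin 0 → F) 0 (fun x y _ => Subsingleton.elim x y) ?_ fun x => ?_
  · rw [h, finrank_zero_of_subsingleton]
    simp
  · simp

theorem InSpan.smul_left_prod [CharP F 2] [FiniteDimensional F V] {q : QuadraticForm F V} {c : F}
    (hc : c ≠ 0) (h : InSpan u v q) :
    InSpan u v (QuadraticMap.prod (c • binQF F 1 u) q) := by
  obtain ⟨k, l, lam, mu, hlam, hmu, h⟩ := h
  refine ⟨k + 1, l, Fin.cons c lam, mu, Fin.cases hc hlam, hmu, ?_⟩
  refine ((WittRel.refl (c • binQF F 1 u)).prod h).trans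
    ((nonsingular_smul_binQF hc _ _).prod (nonsingular_kernelForm u v hlam hmu))
    (.of_isometric ?_)
  exact (QIsometric.prodAssoc _ _ _).symm.trans (.prod (QIsometric.pi_succ fun i =>
    (Fin.cons c lam : Fin (k + 1) → F) i • binQF F 1 u).symm (.refl _))

theorem InSpan.smul_right_prod [CharP F 2] [FiniteDimensional F V] {q : QuadraticForm F V} {c : F}
    (hc : c ≠ 0) (h : InSpan u v q) :
    InSpan u v (QuadraticMap.prod (c • binQF F 1 v) q) := by
  obtain ⟨k, l, lam, mu, hlam, hmu, h⟩ := h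
  refine ⟨k, l + 1, lam, Fin.cons c mu, hlam, Fin.cases hc hmu, ?_⟩
  refine ((WittRel.refl (c • binQF F 1 v)).prod h).trans
    ((nonsingular_smul_binQF hc _ _).prod (nonsingular_kernelForm u v hlam hmu))
    (.of_isometric ?_)
  exact (QIsometric.prod_swap_left _ _ _).trans (.prod (.refl _) (QIsometric.pi_succ fun i =>
    (Fin.cons c mu : Fin (l + 1) → F) i • binQF F 1 v).symm)

theorem InSpan.hyperbolic_prod [CharP F 2] [FiniteDimensional F V] {q : QuadraticForm F V}
    (hq : Nonsingular F q) (h : InSpan u v q) :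
    InSpan u v (QuadraticMap.prod (binQF F 0 0) q) :=
  .of_wittRel hq ((wittRel_binQF_zero_zero.prod (.refl q)).trans (nonsingular_zero.prod hq)
    (.of_isometric (.zero_prod _ _))) h

end KernelForm

section Biquadratic

open scoped TensorProduct

variable {E : Type} [Field E] [Algebra F E]
  {V V₁ V₂ : Type} [AddCommGroup V] [Module F V] [AddCommGroup V₁] [Module F V₁]
  [AddCommGroup V₂] [Module F V₂]

theorem scalarExt_eq_zero [CharP F 2] {u v : F} {μ ν : E}
    (hμ : μ ^ 2 + μ + algebraMap F E u = 0) (hν : ν ^ 2 + ν + algebraMap F E v = 0)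
    (hli : LinearIndependent F ![1, μ, ν, μ * ν]) (q : QuadraticForm F V) (a b x : V)
    (h : scalarExt E q (1 ⊗ₜ a + μ ⊗ₜ b + ν ⊗ₜ x) = 0) :
    q a + u * q b + v * q x = 0 ∧ q b + polar q a b = 0 ∧ q x + polar q a x = 0 ∧
      polar q b x = 0 := by
  have := charP_of_injective_algebraMap (algebraMap F E).injective 2
  rw [QuadraticMap.map_add (scalarExt E q), QuadraticMap.map_add (scalarExt E q), polar_add_left,
    polar_scalarExt_tmul, polar_scalarExt_tmul, polar_scalarExt_tmul, scalarExt_tmul,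
    scalarExt_tmul, scalarExt_tmul] at h
  have := Fintype.linearIndependent_iff.1 hli
    ![q a + u * q b + v * q x, q b + polar q a b, q x + polar q a x, polar q b x] (by
      simp only [Fin.sum_univ_four, Matrix.cons_val, Algebra.smul_def, map_add, map_mul]
      linear_combination h - algebraMap F E (q b) * hμ - algebraMap F E (q x) * hν +
        ((algebraMap F E u + μ) * algebraMap F E (q b)
          + (algebraMap F E v + ν) * algebraMap F E (q x))
          * CharTwo.two_eq_zero (R := E))
  exact ⟨this 0, this 1, this 2, this 3⟩

theorem exists_mem_of_half_finrank_le {U : Type} [AddCommGroup U] [Module E U] [Module F U]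
    [IsScalarTower F E U] [FiniteDimensional F E] [FiniteDimensional E U] [FiniteDimensional F V]
    (hE : finrank F E = 4) (T : U ≃ₗ[F] (Fin 4 → V)) (L : Submodule E U)
    (hL : finrank E U ≤ 2 * finrank E L) (h : ∀ w ∈ L, T w 2 = 0 → T w 3 = 0 → w = 0) (y z : V) :
    ∃ w ∈ L, T w 2 = y ∧ T w 3 = z := by
  let c : L →ₗ[F] (Fin 4 → V) := T.toLinearMap ∘ₗ L.subtype.restrictScalars F
  let g : L →ₗ[F] V × V := (LinearMap.proj 2 ∘ₗ c).prod (LinearMap.proj 3 ∘ₗ c)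
  have hg : Function.Injective g := by
    refine (injective_iff_map_eq_zero g).2 fun w hw => ?_
    obtain ⟨h2, h3⟩ := Prod.ext_iff.1 hw
    exact Subtype.ext (h w w.2 h2 h3)
  have : FiniteDimensional F L := Module.Finite.trans E L
  have h1 := finrank_mul_finrank F E L
  have h2 := finrank_mul_finrank F E U
  have h3 : finrank F U = 4 * finrank F V := by
    rw [T.finrank_eq, finrank_pi_fintype]
    simp
  have h4 := LinearMap.finrank_range_of_inj hg
  have hsurj : LinearMap.range g = ⊤ := by
    refine Submodule.eq_top_of_finrank_eq (le_antisymm (Submodule.finrank_le _) ?_)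
    rw [h4, finrank_prod]
    rw [hE] at h1 h2
    omega
  obtain ⟨w, hw⟩ := LinearMap.range_eq_top.1 hsurj (y, z)
  obtain ⟨h2, h3⟩ := Prod.ext_iff.1 hw
  exact ⟨w, w.2, h2, h3⟩

theorem Neutral.exists_submodule {q : QuadraticForm F V} (h : Neutral E q) :
    ∃ L : Submodule E (E ⊗[F] V), finrank E (E ⊗[F] V) ≤ 2 * finrank E L ∧
      ∀ w ∈ L, scalarExt E q w = 0 := by
  obtain ⟨L, hL, hq⟩ := h
  refine ⟨L.map (LinearMap.fst E _ _), ?_, ?_⟩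
  · rw [finrank_fin_fun, add_zero] at hL
    rwa [← (Submodule.equivMapOfInjective (LinearMap.fst E (E ⊗[F] V) (Fin 0 → E))
      (fun x y hxy => Prod.ext hxy (Subsingleton.elim _ _)) L).finrank_eq]
  · rintro _ ⟨w, hw, rfl⟩
    exact hq w hw

theorem exists_vectors_of_neutral [CharP F 2] [FiniteDimensional F V] {u v : F} {μ ν : E}
    (hμ : μ ^ 2 + μ + algebraMap F E u = 0) (hν : ν ^ 2 + ν + algebraMap F E v = 0)
    (b : Basis (Fin 4) F E) (hb : ⇑b = ![1, μ, ν, μ * ν]) {q : QuadraticForm F V}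
    (h : Neutral E q) (ha : ∀ x y, q x = u * q y → polar q x y = q y → x = 0 ∧ y = 0) (x : V) :
    ∃ a₀ a₁, q a₀ + u * q a₁ + v * q x = 0 ∧ q a₁ + polar q a₀ a₁ = 0 ∧
      q x + polar q a₀ x = 0 ∧ polar q a₁ x = 0 := by
  have := Module.Finite.of_basis b
  obtain ⟨L, hL, hq⟩ := h.exists_submodule
  have hli := b.linearIndependent
  rw [hb] at hli
  have hc (w) (hw : w ∈ L) (h3 : tensorCoord b V w 3 = 0) : scalarExt E q (1 ⊗ₜ tensorCoord b V w 0
      + μ ⊗ₜ tensorCoord b V w 1 + ν ⊗ₜ tensorCoord b V w 2) = 0 := by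
    have := sum_tensorCoord b w
    simp only [Fin.sum_univ_four, h3, TensorProduct.tmul_zero, add_zero, hb, Matrix.cons_val]
      at this
    rw [this, hq w hw]
  obtain ⟨w, hw, h2, h3⟩ := exists_mem_of_half_finrank_le
    (by simp [finrank_eq_card_basis b]) (tensorCoord b V) L hL (fun w hw h2 h3 => by
      obtain ⟨h4, h5, -, -⟩ := scalarExt_eq_zero hμ hν hli q _ _ _ (hc w hw h3)
      rw [h2, map_zero, mul_zero, add_zero] at h4
      obtain ⟨h0, h1⟩ := ha _ _ (CharTwo.add_eq_zero.1 h4) (CharTwo.add_eq_zero.1 h5).symm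
      refine (tensorCoord b V).map_eq_zero_iff.1 (funext fun i => ?_)
      fin_cases i
      exacts [h0, h1, h2, h3]) x 0
  have := scalarExt_eq_zero hμ hν hli q _ _ _ (hc w hw h3)
  rw [h2] at this
  exact ⟨_, _, this⟩

theorem InSpan.of_isotropic [CharP F 2] [FiniteDimensional F E] {u v : F} {n : ℕ}
    (ih : ∀ m < n, ∀ (V : Type) [AddCommGroup V] [Module F V] [FiniteDimensional F V],
      finrank F V = m → ∀ q : QuadraticForm F V, Nonsingular F q → Neutral E q → InSpan u v q)
    {V : Type} [AddCommGroup V] [Module F V] [FiniteDimensional F V] (hn : finrank F V < n + 2)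
    {q : QuadraticForm F V} (hq : Nonsingular F q) (h : Neutral E q) {x : V} (hx : x ≠ 0)
    (hqx : q x = 0) : InSpan u v q := by
  obtain ⟨W, hW, hiso⟩ := exists_isometric_hyperbolic_prod hq hx hqx
  have := finrank_add_two_eq hiso
  exact .of_wittRel (.of_isometric hiso hq) (.of_isometric hiso)
    (.hyperbolic_prod hW (ih (finrank F W) (by omega) W rfl _ hW
      (.of_prod (nonsingular_binQF _ _) neutral_binQF_zero_zero (h.of_isometric hiso))))

theorem inSpan_of_neutral [CharP F 2] {u v : F} {μ ν : E}
    (hμ : μ ^ 2 + μ + algebraMap F E u = 0) (hν : ν ^ 2 + ν + algebraMap F E v = 0)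
    (b : Basis (Fin 4) F E) (hb : ⇑b = ![1, μ, ν, μ * ν]) (n : ℕ) (V : Type) [AddCommGroup V]
    [Module F V] [FiniteDimensional F V] (hn : finrank F V = n) (q : QuadraticForm F V)
    (hq : Nonsingular F q) (h : Neutral E q) : InSpan u v q := by
  have := Module.Finite.of_basis b
  induction n using Nat.strong_induction_on generalizing V with
  | _ n ih =>
  have of_isotropic {x : V} (hx : x ≠ 0) (hqx : q x = 0) : InSpan u v q :=
    .of_isotropic ih (by omega) hq h hx hqx
  have of_plane {w : F} {τ : E} (hτ : τ ^ 2 + τ + algebraMap F E w = 0)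
      (hw : ∀ {W : Submodule F V} {c : F}, c ≠ 0 → InSpan u v (q.comp W.subtype) →
        InSpan u v (QuadraticMap.prod (c • binQF F 1 w) (q.comp W.subtype))) {x y : V}
      (hqy : q y ≠ 0) (hxy : q x = w * q y) (hp : polar q x y = q y) : InSpan u v q := by
    obtain ⟨W, hW, hiso, -⟩ := exists_isometric_prod hq y x hqy (by rw [polar_comm, hp])
      (q y • binQF F 1 w) fun z => by
        rw [FunLike.coe_smul, Pi.smul_apply, binQF_apply, hxy, smul_eq_mul]
        ring
    have := finrank_add_two_eq hiso
    exact .of_wittRel (.of_isometric hiso hq) (.of_isometric hiso)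
      (hw hqy (ih (finrank F W) (by omega) W rfl _ hW
        (.of_prod (nonsingular_smul_binQF hqy _ _) (neutral_smul_binQF hqy hτ)
          (h.of_isometric hiso))))
  by_cases ha : ∀ x y, q x = u * q y → polar q x y = q y → x = 0 ∧ y = 0
  swap
  · push Not at ha
    obtain ⟨x, y, hxy, hp, hne⟩ := ha
    by_cases hqy : q y = 0
    · by_cases hy : y = 0
      · exact of_isotropic (fun hx => hne hx hy) (by rw [hxy, hqy, mul_zero])
      · exact of_isotropic hy hqy
    · exact of_plane hμ InSpan.smul_left_prod hqy hxy hp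
  rcases subsingleton_or_nontrivial V with hV | hV
  · exact inSpan_of_finrank_eq_zero _ finrank_zero_of_subsingleton
  obtain ⟨x, hx⟩ := exists_ne (0 : V)
  have hqx : q x ≠ 0 := fun hqx => hx (ha x 0 (by simp [hqx]) (by simp)).1
  obtain ⟨a₀, a₁, h1, h2, h3, h4⟩ := exists_vectors_of_neutral hμ hν b hb h ha x
  have h2 := (CharTwo.add_eq_zero.1 h2).symm
  have h3 := (CharTwo.add_eq_zero.1 h3).symm
  by_cases hc : q a₁ = 0
  · rw [hc, mul_zero, add_zero] at h1
    exact of_plane hν InSpan.smul_right_prod hqx (CharTwo.add_eq_zero.1 h1) h3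
  let β : QF F 2 := q x • binQF F 1 v
  have hβ : Nonsingular F β := nonsingular_smul_binQF hqx _ _
  let q' := QuadraticMap.prod β q
  have hq' : Nonsingular F q' := hβ.prod hq
  have hN : Neutral E q' := .prod (neutral_smul_binQF hqx hν) h
  have hβ_apply (z) : β z = q x * (z 0 ^ 2 + z 0 * z 1 + v * z 1 ^ 2) := by
    simp [β, binQF_apply]
  have hβ_polar (z w) : polar β z w = q x * (z 0 * w 1 + z 1 * w 0) := by
    rw [FunLike.coe_smul, polar_smul, polar_binQF, smul_eq_mul]
  have hq'_polar (z w) : polar q' z w = polar β z.1 w.1 + polar q z.2 w.2 := polar_prod _ _ _ _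
  have hq'_apply (z) : q' z = β z.1 + q z.2 := rfl
  have hX : q' (0, a₁) = q a₁ := by simp [q']
  have hY : q' (Pi.single 1 1, a₀) = u * q a₁ := by
    rw [hq'_apply, hβ_apply]
    simp
    linear_combination h1 - u * q a₁ * CharTwo.two_eq_zero (R := F)
  obtain ⟨W, hW, hiso, hmem⟩ := exists_isometric_prod hq' (0, a₁) (Pi.single 1 1, a₀) hc
    (by rw [hq'_polar, polar_zero_left, zero_add, polar_comm, h2]) (q a₁ • binQF F 1 u) fun z => by
      rw [FunLike.coe_smul, Pi.smul_apply, binQF_apply, hX, hY, smul_eq_mul]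
      ring
  have hw : ((Pi.single 0 1, x) : (Fin 2 → F) × V) ∈ W := by
    refine (hmem _).2 ⟨?_, ?_⟩
    · rw [hq'_polar, polar_zero_right, zero_add, polar_comm, h4]
    · rw [hq'_polar, hβ_polar, polar_comm q, h3]
      simp [CharTwo.add_self_eq_zero]
  have hqw : q' (Pi.single 0 1, x) = 0 := by
    rw [hq'_apply, hβ_apply]
    simp [CharTwo.add_self_eq_zero]
  have hNW : Neutral E (q'.comp W.subtype) :=
    .of_prod (nonsingular_smul_binQF hc _ _) (neutral_smul_binQF hc hμ) (hN.of_isometric hiso)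
  have hd := finrank_add_two_eq hiso
  rw [finrank_prod, finrank_fin_fun] at hd
  have hSW : InSpan u v (q'.comp W.subtype) :=
    .of_isotropic ih (by omega) hW hNW (x := ⟨_, hw⟩)
      (fun h => hx (Prod.ext_iff.1 (Subtype.ext_iff.1 h)).2) hqw
  have hS : InSpan u v q' :=
    .of_wittRel (.of_isometric hiso hq') (.of_isometric hiso) (.smul_left_prod hc hSW)
  exact .of_wittRel (hβ.prod hq') (WittRel.refl q').prod_of_prod_left (.smul_right_prod hqx hS)

theorem neutral_kernelForm [CharP F 2] {u v : F} {μ ν : E}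
    (hμ : μ ^ 2 + μ + algebraMap F E u = 0) (hν : ν ^ 2 + ν + algebraMap F E v = 0)
    {k l : ℕ} {lam : Fin k → F} {mu : Fin l → F} (hlam : ∀ i, lam i ≠ 0) (hmu : ∀ i, mu i ≠ 0) :
    Neutral E (kernelForm u v lam mu) :=
  .prod (.pi fun i => neutral_smul_binQF (hlam i) hμ) (.pi fun i => neutral_smul_binQF (hmu i) hν)

theorem inWqKernel_iff [CharP F 2] {u v : F} {μ ν : E}
    (hμ : μ ^ 2 + μ + algebraMap F E u = 0) (hν : ν ^ 2 + ν + algebraMap F E v = 0)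
    (b : Basis (Fin 4) F E) (hb : ⇑b = ![1, μ, ν, μ * ν]) {n : ℕ} {q : QF F n}
    (hq : Nonsingular F q) :
    InWqKernel F E q ↔ ∃ (k l : ℕ) (lam : Fin k → F) (mu : Fin l → F),
      (∀ i, lam i ≠ 0) ∧ (∀ i, mu i ≠ 0) ∧
      WittEquiv F q (oSum F (oSumFam F fun i => lam i • binQF F 1 u)
        (oSumFam F fun i => mu i • binQF F 1 v)) := by
  have := Module.Finite.of_basis b
  rw [inWqKernel_iff_neutral hq]
  constructor
  · intro h
    obtain ⟨k, l, lam, mu, hlam, hmu, h⟩ := inSpan_of_neutral hμ hν b hb _ _ rfl q hq h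
    have hn := nonsingular_kernelForm u v hlam hmu
    have hiso := (isometric_kernelForm u v lam mu).symm
    exact ⟨k, l, lam, mu, hlam, hmu,
      (h.trans hn (.of_isometric hiso)).wittEquiv hq (.of_isometric hiso hn)⟩
  · rintro ⟨k, l, lam, mu, hlam, hmu, h⟩
    have hn := nonsingular_kernelForm u v hlam hmu
    have hiso := isometric_kernelForm u v lam mu
    have hn' := Nonsingular.of_isometric hiso.symm hn
    exact .of_wittRel hn ((WittRel.of_wittEquiv hn' h).trans hn' (.of_isometric hiso))
      (neutral_kernelForm hμ hν hlam hmu)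

end Biquadratic

/-- The subspace witnessing the Witt equivalence of `⟨⟨(e+u)(e+v)(e+u+v), d/e²]]` and
`⟨1,r,rs,rst⟩_b ⊗ [1,u] ⊥ ⟨r,rst⟩_b ⊗ [1,v]`, as the image of an injective linear map. -/
noncomputable def pfisterMap (u v e : F) : (Fin 8 → F) →ₗ[F]
    ((Fin 2 → F) × (Fin 2 → F)) × ((Fin 4 → Fin 2 → F) × (Fin 2 → Fin 2 → F)) where
  toFun x :=
    ((![(e + u) * x 1 + (e + u) * (e + v) * (e + u + v) / e * x 3 + x 4
          + (u ^ 2 + v ^ 2 + u * v) / e * x 0, x 0],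
      ![x 2 + x 0 / e + x 6 + x 7 + (u ^ 2 + v ^ 2 + u * v) / e * x 3, x 3]),
     (![![x 4, x 0], ![x 5, x 1], ![x 1 + (e + u + v) * x 3, x 2], ![x 6, x 3]],
      ![![x 5 + x 0 + (e + v) * x 2, x 1], ![x 7, x 3]]))
  map_add' x y := by
    ext i j <;> fin_cases i <;> (try fin_cases j) <;> simp <;> ring
  map_smul' c x := by
    ext i j <;> fin_cases i <;> (try fin_cases j) <;> simp <;> ring

theorem pfisterMap_injective (u v e : F) : Function.Injective (pfisterMap u v e) := by
  rw [injective_iff_map_eq_zero]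
  intro x hx
  simp only [pfisterMap, LinearMap.coe_mk, AddHom.coe_mk, Prod.ext_iff, funext_iff,
    Fin.forall_fin_succ] at hx
  ext i
  fin_cases i <;> simp_all

theorem wittRel_pf2 [CharP F 2] {u v e : F} (he : e ≠ 0) :
    WittRel (pf2 F ((e + u) * (e + v) * (e + u + v))
        ((u ^ 2 * v + u * v ^ 2 + u ^ 2 * v ^ 2 + u ^ 4 + v ^ 4) / e ^ 2))
      (kernelForm u v ![1, e + u, (e + u) * (e + v), (e + u) * (e + v) * (e + u + v)]
        ![e + u, (e + u) * (e + v) * (e + u + v)]) := by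
  refine .of_isometric_left (.of_oSum _ _) (.of_injective (pfisterMap u v e)
    (pfisterMap_injective u v e) (by simp [finrank_pi_fintype]) fun x => ?_)
  simp only [pfisterMap, kernelForm, LinearMap.coe_mk, AddHom.coe_mk, prod_apply, pi_apply,
    FunLike.coe_smul, Pi.smul_apply, binQF_apply, Fin.sum_univ_succ, smul_eq_mul]
  simp
  field_simp
  grind

theorem nonsingular_pf2 [CharP F 2] {g : F} (hg : g ≠ 0) (h : F) : Nonsingular F (pf2 F g h) :=
  .of_isometric (QIsometric.of_oSum _ _).symm
    ((nonsingular_binQF _ _).prod (nonsingular_smul_binQF hg _ _))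

theorem wittEquiv_pf2 [CharP F 2] {u v e : F} (he : e ≠ 0)
    (hg : (e + u) * (e + v) * (e + u + v) ≠ 0) :
    WittEquiv F (pf2 F ((e + u) * (e + v) * (e + u + v))
        ((u ^ 2 * v + u * v ^ 2 + u ^ 2 * v ^ 2 + u ^ 4 + v ^ 4) / e ^ 2))
      (oSum F
        (oSumFam F fun i : Fin 4 =>
          (![1, e + u, (e + u) * (e + v), (e + u) * (e + v) * (e + u + v)] i) • binQF F 1 u)
        (oSumFam F fun i : Fin 2 =>
          (![e + u, (e + u) * (e + v) * (e + u + v)] i) • binQF F 1 v)) := by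
  have hrs := left_ne_zero_of_mul hg
  have hr := left_ne_zero_of_mul hrs
  have hn := nonsingular_kernelForm u v
    (lam := ![1, e + u, (e + u) * (e + v), (e + u) * (e + v) * (e + u + v)])
    (mu := ![e + u, (e + u) * (e + v) * (e + u + v)])
    (by simpa [Fin.forall_fin_succ, -mul_eq_zero] using ⟨hr, hrs, hg⟩)
    (by simpa [Fin.forall_fin_succ, -mul_eq_zero] using ⟨hr, hg⟩)
  have hiso := isometric_kernelForm u v
    ![1, e + u, (e + u) * (e + v), (e + u) * (e + v) * (e + u + v)]
    ![e + u, (e + u) * (e + v) * (e + u + v)]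
  exact ((wittRel_pf2 he).trans hn (.of_isometric hiso.symm)).wittEquiv (nonsingular_pf2 hg _)
    (.of_isometric hiso.symm hn)

section Generator

variable {E : Type} [Field E] [Algebra F E] {u v : F} {μ ν : E}

/-- The standard basis of a biquadratic extension. -/
theorem exists_biquadratic_basis
    (hμ : μ ^ 2 + μ + algebraMap F E u = 0) (hν : ν ^ 2 + ν + algebraMap F E v = 0)
    (hdim : finrank F E = 4) (hE : IntermediateField.adjoin F {μ, ν} = ⊤) :
    ∃ b : Basis (Fin 4) F E, ⇑b = ![1, μ, ν, μ * ν] := by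
  have hspan : ⊤ ≤ Submodule.span F (Set.range ![1, μ, ν, μ * ν]) := by
    have hmem : ∀ i, ![1, μ, ν, μ * ν] i ∈ Submodule.span F (Set.range ![1, μ, ν, μ * ν]) :=
      fun i => Submodule.subset_span ⟨i, rfl⟩
    have h0 := hmem 0
    have h1 := hmem 1
    have h2 := hmem 2
    have h3 := hmem 3
    simp only [Matrix.cons_val] at h0 h1 h2 h3
    set S := Submodule.span F (Set.range ![1, μ, ν, μ * ν])
    have hmul {τ y : E} {w : F} (hτ : τ ^ 2 + τ + algebraMap F E w = 0) (hy : y ∈ S)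
        (hτy : τ * y ∈ S) : τ * (τ * y) ∈ S := by
      have : τ * (τ * y) = -(w • y + τ * y) := by
        rw [Algebra.smul_def]
        linear_combination y * hτ
      rw [this]
      exact S.neg_mem (S.add_mem (S.smul_mem w hy) hτy)
    have hS : ∀ x ∈ S, μ * x ∈ S ∧ ν * x ∈ S := by
      intro x hx
      induction hx using Submodule.span_induction with
      | mem x hx =>
        have h4 := hmul hμ h0 (by rwa [mul_one])
        have h5 := hmul hν h0 (by rwa [mul_one])
        have h6 := hmul hμ h2 h3
        have h7 := hmul hν h1 (by rwa [mul_comm])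
        rw [mul_one] at h4 h5
        rw [mul_comm ν μ] at h7
        obtain ⟨i, rfl⟩ := hx
        fin_cases i <;> simp [*, mul_comm ν μ]
      | zero => simp
      | add x y _ _ hx hy =>
        rw [mul_add, mul_add]
        exact ⟨S.add_mem hx.1 hy.1, S.add_mem hx.2 hy.2⟩
      | smul c x _ hx =>
        rw [mul_smul_comm, mul_smul_comm]
        exact ⟨S.smul_mem c hx.1, S.smul_mem c hx.2⟩
    have : FiniteDimensional F E := .of_finrank_pos (by omega)
    have hadj : Algebra.adjoin F {μ, ν} = ⊤ := by
      rw [← IntermediateField.adjoin_toSubalgebra, hE, IntermediateField.top_toSubalgebra]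
    have hadjS : ∀ x ∈ Algebra.adjoin F {μ, ν}, ∀ y ∈ S, x * y ∈ S := by
      intro x hx
      induction hx using Algebra.adjoin_induction with
      | mem x hx =>
        intro y hy
        rcases hx with rfl | rfl
        exacts [(hS y hy).1, (hS y hy).2]
      | algebraMap c =>
        intro y hy
        rw [← Algebra.smul_def]
        exact S.smul_mem c hy
      | add x y _ _ hx hy =>
        intro z hz
        rw [add_mul]
        exact S.add_mem (hx z hz) (hy z hz)
      | mul x y _ _ hx hy =>
        intro z hz
        rw [mul_assoc]
        exact hx _ (hy z hz)
    intro x _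
    rw [← mul_one x]
    exact hadjS x (hadj ▸ Algebra.mem_top) 1 h0
  exact ⟨basisOfTopLeSpanOfCardEqFinrank _ hspan (by simp [hdim]),
    coe_basisOfTopLeSpanOfCardEqFinrank _ _ _⟩

theorem add_ne_zero_of_biquadratic_basis [CharP F 2]
    (hμ : μ ^ 2 + μ + algebraMap F E u = 0) (hν : ν ^ 2 + ν + algebraMap F E v = 0)
    (b : Basis (Fin 4) F E) (hb : ⇑b = ![1, μ, ν, μ * ν]) : u + v ≠ 0 := by
  intro h
  have := charP_of_injective_algebraMap (algebraMap F E).injective 2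
  have hli := Fintype.linearIndependent_iff.1 b.linearIndependent
  rw [hb] at hli
  have huv : algebraMap F E u = algebraMap F E v := by rw [CharTwo.add_eq_zero.1 h]
  have hmul : (μ + ν) * (μ + ν + 1) = 0 := by grind
  rcases mul_eq_zero.1 hmul with h | h
  · simpa using hli ![0, 1, 1, 0] (by simpa [Fin.sum_univ_succ] using h) 1
  · simpa using hli ![1, 1, 1, 0]
      (by simpa [Fin.sum_univ_succ, add_comm, add_left_comm, add_assoc] using h) 1

theorem adjoin_biquadratic_generator [CharP F 2] (hu : u ≠ 0) (hv : v ≠ 0) (huv : u + v ≠ 0)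
    (hμ : μ ^ 2 + μ + algebraMap F E u = 0) (hν : ν ^ 2 + ν + algebraMap F E v = 0)
    (hE : IntermediateField.adjoin F {μ, ν} = ⊤) :
    IntermediateField.adjoin F {μ * ν + algebraMap F E u + algebraMap F E v} = ⊤ := by
  have := charP_of_injective_algebraMap (algebraMap F E).injective 2
  set γ := μ * ν + algebraMap F E u + algebraMap F E v with hγ
  have hmem := IntermediateField.mem_adjoin_simple_self F γ
  set K := IntermediateField.adjoin F {γ}
  have hF := K.algebraMap_mem
  have hu' : algebraMap F E u ≠ 0 := by simpa using hu
  have hv' : algebraMap F E v ≠ 0 := by simpa using hv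
  have huv' : algebraMap F E u + algebraMap F E v ≠ 0 := by
    rw [← map_add]
    exact (map_ne_zero _).2 huv
  have hw : algebraMap F E v * μ + algebraMap F E u * ν =
      γ ^ 2 + γ + algebraMap F E (u * v + u ^ 2 + v ^ 2 + u + v) := by
    simp only [map_add, map_mul, map_pow]
    grind
  have hwK : algebraMap F E v * μ + algebraMap F E u * ν ∈ K :=
    hw ▸ K.add_mem (K.add_mem (pow_mem hmem 2) hmem) (hF _)
  set w := algebraMap F E v * μ + algebraMap F E u * ν with hw'
  have hνK : ν ∈ K := by
    have : ν = (algebraMap F E v * w + w ^ 2) / algebraMap F E (u * (u + v))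
        + algebraMap F E v := by
      simp only [map_add, map_mul]
      field_simp
      grind
    rw [this]
    exact K.add_mem (K.div_mem (K.add_mem (K.mul_mem (hF _) hwK) (pow_mem hwK 2)) (hF _)) (hF _)
  have hμK : μ ∈ K := by
    have : μ = (w - algebraMap F E u * ν) / algebraMap F E v := by
      field_simp
      rw [hw']
      ring
    rw [this]
    exact K.div_mem (K.sub_mem hwK (K.mul_mem (hF _) hνK)) (hF _)
  rw [eq_top_iff, ← hE, IntermediateField.adjoin_le_iff]
  rintro x (rfl | rfl)
  exacts [hμK, hνK]

open Polynomial in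
theorem minpoly_biquadratic_generator [CharP F 2]
    (hμ : μ ^ 2 + μ + algebraMap F E u = 0) (hν : ν ^ 2 + ν + algebraMap F E v = 0)
    (hdim : finrank F E = 4)
    (htop : IntermediateField.adjoin F {μ * ν + algebraMap F E u + algebraMap F E v} = ⊤) :
    minpoly F (μ * ν + algebraMap F E u + algebraMap F E v) =
      X ^ 4 + X ^ 3 + C (u ^ 2 + v ^ 2 + u * v) * X
        + C (u ^ 2 * v + u * v ^ 2 + u ^ 2 * v ^ 2 + u ^ 4 + v ^ 4) := by
  have := charP_of_injective_algebraMap (algebraMap F E).injective 2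
  have : FiniteDimensional F E := .of_finrank_pos (by omega)
  have hint := Algebra.IsIntegral.isIntegral (R := F)
    (μ * ν + algebraMap F E u + algebraMap F E v)
  have hdeg := (Field.primitive_element_iff_minpoly_natDegree_eq F _).1 htop
  refine (eq_of_monic_of_dvd_of_natDegree_le (minpoly.monic hint) (by monicity!)
    (minpoly.dvd F _ ?_) ?_).symm
  · simp only [map_add, map_mul, map_pow, aeval_X, aeval_C]
    grind
  · rw [hdeg, hdim]
    compute_degree

end Generator

end WittKernel

open Polynomial in
/-- for a separable biquadratic extension `E = F(μ,ν)` of degree 4 in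
characteristic 2 with `μ² + μ + u = 0`, `ν² + ν + v = 0`, setting `γ = μν + u + v` one has
`E = F(γ)` with minimal polynomial `f = X⁴ + X³ + (u²+v²+uv)X + d`,
`d = u²v + uv² + u²v² + u⁴ + v⁴`, the cubic resolvent is
`X³ + (u²+v²+uv)X + (u²v+uv²) = (X+u)(X+v)(X+u+v)`, in `W_qF` one has
`⟨⟨f_C(e), d/e²]] = ⟨1,r,rs,rst⟩_b ⊗ [1,u] + ⟨r,rst⟩_b ⊗ [1,v]` with `r = e+u`, `s = e+v`,
`t = e+u+v`, and consequently `W_q(E/F)` is generated as a `WF`-module by `[1,u]` and `[1,v]`. -/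
theorem stmt_13 (F : Type) [Field F] [CharP F 2] (E : Type) [Field E] [Algebra F E]
    (u v : F) (hu : u ≠ 0) (hv : v ≠ 0) (μ ν : E)
    (hμ : μ ^ 2 + μ + algebraMap F E u = 0) (hν : ν ^ 2 + ν + algebraMap F E v = 0)
    (hdim : Module.finrank F E = 4)
    (hE : IntermediateField.adjoin F {μ, ν} = ⊤) :
    IntermediateField.adjoin F {μ * ν + algebraMap F E u + algebraMap F E v} = ⊤ ∧
    minpoly F (μ * ν + algebraMap F E u + algebraMap F E v) =
      X ^ 4 + X ^ 3 + C (u ^ 2 + v ^ 2 + u * v) * X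
        + C (u ^ 2 * v + u * v ^ 2 + u ^ 2 * v ^ 2 + u ^ 4 + v ^ 4) ∧
    (∀ e : F, cubicResolvent F 1 0 (u ^ 2 + v ^ 2 + u * v)
        (u ^ 2 * v + u * v ^ 2 + u ^ 2 * v ^ 2 + u ^ 4 + v ^ 4) e =
      e ^ 3 + (u ^ 2 + v ^ 2 + u * v) * e + (u ^ 2 * v + u * v ^ 2)) ∧
    (∀ e : F, cubicResolvent F 1 0 (u ^ 2 + v ^ 2 + u * v)
        (u ^ 2 * v + u * v ^ 2 + u ^ 2 * v ^ 2 + u ^ 4 + v ^ 4) e =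
      (e + u) * (e + v) * (e + u + v)) ∧
    (∀ e : F, e ≠ 0 →
      cubicResolvent F 1 0 (u ^ 2 + v ^ 2 + u * v)
        (u ^ 2 * v + u * v ^ 2 + u ^ 2 * v ^ 2 + u ^ 4 + v ^ 4) e ≠ 0 →
      WittEquiv F
        (pf2 F (cubicResolvent F 1 0 (u ^ 2 + v ^ 2 + u * v)
            (u ^ 2 * v + u * v ^ 2 + u ^ 2 * v ^ 2 + u ^ 4 + v ^ 4) e)
          ((u ^ 2 * v + u * v ^ 2 + u ^ 2 * v ^ 2 + u ^ 4 + v ^ 4) / e ^ 2))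
        (oSum F
          (oSumFam F fun i : Fin 4 =>
            (![1, e + u, (e + u) * (e + v), (e + u) * (e + v) * (e + u + v)] i) • binQF F 1 u)
          (oSumFam F fun i : Fin 2 =>
            (![e + u, (e + u) * (e + v) * (e + u + v)] i) • binQF F 1 v))) ∧
    (∀ (N : ℕ) (φ : QF F N), Nonsingular F φ →
      (InWqKernel F E φ ↔
        ∃ (k l : ℕ) (lam : Fin k → F) (mu : Fin l → F),
          (∀ i, lam i ≠ 0) ∧ (∀ i, mu i ≠ 0) ∧
          WittEquiv F φ (oSum F (oSumFam F fun i => lam i • binQF F 1 u)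
            (oSumFam F fun i => mu i • binQF F 1 v)))) := by
  have hres (e : F) : cubicResolvent F 1 0 (u ^ 2 + v ^ 2 + u * v)
      (u ^ 2 * v + u * v ^ 2 + u ^ 2 * v ^ 2 + u ^ 4 + v ^ 4) e =
      (e + u) * (e + v) * (e + u + v) := by
    unfold cubicResolvent
    grind
  obtain ⟨b, hb⟩ := exists_biquadratic_basis hμ hν hdim hE
  have htop := adjoin_biquadratic_generator hu hv
    (add_ne_zero_of_biquadratic_basis hμ hν b hb) hμ hν hE
  refine ⟨htop, minpoly_biquadratic_generator hμ hν hdim htop, fun e => ?_, hres,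
    fun e he hg => ?_, fun N φ hφ => inWqKernel_iff hμ hν b hb hφ⟩
  · rw [hres]
    grind
  · rw [hres] at hg ⊢
    exact wittEquiv_pf2 he hg
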